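/- arXiv:2212.06880 — 10 statements merged into one kernel-verified Lean document; each statement's English description precedes it below -/
import Mathlib

section
/- Fix integers N ≥ 1, r ≥ 1, let Ω ⊆ ℂ^N be an open set of tuples c = (c₁,…,c_N) with pairwise distinct entries, and let L¹,…,L^N : Ω → Matrix (Fin r) (Fin r) ℂ be differentiable. Define A(z,c) := Σ_{μ=1}^N (z − c_μ)⁻¹ • L^μ(c) for z ∉ {c₁,…,c_N}. Then the following are equivalent: (i) for every ν, every c ∈ Ω and every z ∉ {c₁,…,c_N}, the directional derivative of c ↦ A(z,c) along the ν-th coordinate equals (z − c_ν)⁻² • L^ν(c) + [ −(z − c_ν)⁻¹ • L^ν(c), A(z,c) ]; (ii) the Schlesinger equations hold on Ω: for all μ ≠ ν, ∂_{c_ν} L^μ = (c_μ − c_ν)⁻¹ • (L^μ L^ν − L^ν L^μ), and for every μ, ∂_{c_μ} L^μ = − Σ_{ν ≠ μ} (c_μ − c_ν)⁻¹ • (L^μ L^ν − L^ν L^μ). -/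
open Matrix

attribute [local instance] Matrix.normedAddCommGroup Matrix.normedSpace

theorem cauchy_indep_scalar {N : ℕ} (c : Fin N → ℂ) (hc : ∀ i j, i ≠ j → c i ≠ c j)
    (x : Fin N → ℂ)
    (h : ∀ z : ℂ, (∀ μ, z ≠ c μ) → ∑ μ, (z - c μ)⁻¹ * x μ = 0) (ν : Fin N) : x ν = 0 := by
  let f : ℂ → ℂ := fun z => x ν + ∑ μ ∈ Finset.univ.erase ν, (z - c ν) * ((z - c μ)⁻¹ * x μ)
  have hf : ContinuousAt f (c ν) := by
    refine continuousAt_const.add (tendsto_finsetSum _ fun μ hμ => ?_)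
    have hne : c ν - c μ ≠ 0 := sub_ne_zero.2 (hc _ _ (Finset.ne_of_mem_erase hμ).symm)
    have : ContinuousAt (fun z : ℂ => (z - c ν) * ((z - c μ)⁻¹ * x μ)) (c ν) := by
      fun_prop (disch := assumption)
    exact this
  have hev : ∀ᶠ z in nhdsWithin (c ν) {c ν}ᶜ, f z = 0 := by
    have h1 : ∀ᶠ z in nhdsWithin (c ν) {c ν}ᶜ, ∀ μ, z ≠ c μ := by
      rw [Filter.eventually_all]
      intro μ
      by_cases hμ : μ = ν
      · subst hμ
        exact self_mem_nhdsWithin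
      · exact (eventually_ne_nhds (hc _ _ (Ne.symm hμ))).filter_mono nhdsWithin_le_nhds
    filter_upwards [h1] with z hz
    have h2 := h z hz
    rw [← Finset.add_sum_erase _ _ (Finset.mem_univ ν)] at h2
    have h3 : z - c ν ≠ 0 := sub_ne_zero.2 (hz ν)
    have h4 : f z = (z - c ν) * ((z - c ν)⁻¹ * x ν +
        ∑ μ ∈ Finset.univ.erase ν, (z - c μ)⁻¹ * x μ) := by
      simp only [f]
      rw [mul_add, Finset.mul_sum, mul_inv_cancel_left₀ h3]
    rw [h4, h2, mul_zero]
  have h5 : Filter.Tendsto f (nhdsWithin (c ν) {c ν}ᶜ) (nhds 0) :=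
    (Filter.tendsto_congr' hev).2 tendsto_const_nhds
  have h6 := tendsto_nhds_unique (hf.tendsto.mono_left nhdsWithin_le_nhds) h5
  simpa [f] using h6

theorem cauchy_indep {N r : ℕ} (c : Fin N → ℂ) (hc : ∀ i j, i ≠ j → c i ≠ c j)
    (X Y : Fin N → Matrix (Fin r) (Fin r) ℂ)
    (h : ∀ z : ℂ, (∀ μ, z ≠ c μ) →
      ∑ μ, (z - c μ)⁻¹ • X μ = ∑ μ, (z - c μ)⁻¹ • Y μ) (ν : Fin N) : X ν = Y ν := by
  ext i j
  refine sub_eq_zero.1 (cauchy_indep_scalar c hc (fun μ => X μ i j - Y μ i j) ?_ ν)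
  intro z hz
  have := congrFun (congrFun (h z hz) i) j
  simp only [Matrix.sum_apply, Matrix.smul_apply, smul_eq_mul] at this
  simp only [mul_sub, Finset.sum_sub_distrib, this, sub_self]

/-- The right-hand sides of the Schlesinger equations. -/
noncomputable def schlesRhs {N r : ℕ} (c : Fin N → ℂ) (M : Fin N → Matrix (Fin r) (Fin r) ℂ)
    (ν μ : Fin N) : Matrix (Fin r) (Fin r) ℂ :=
  if μ = ν then -∑ κ ∈ Finset.univ.filter (fun κ => κ ≠ ν),
      (c ν - c κ)⁻¹ • (M ν * M κ - M κ * M ν)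
  else (c μ - c ν)⁻¹ • (M μ * M ν - M ν * M μ)

theorem commutator_eq {N r : ℕ} (c : Fin N → ℂ) (hc : ∀ i j, i ≠ j → c i ≠ c j)
    (M : Fin N → Matrix (Fin r) (Fin r) ℂ) (ν : Fin N) (z : ℂ) (hz : ∀ μ, z ≠ c μ) :
    ((-(z - c ν)⁻¹) • M ν) * (∑ μ : Fin N, (z - c μ)⁻¹ • M μ) -
      (∑ μ : Fin N, (z - c μ)⁻¹ • M μ) * ((-(z - c ν)⁻¹) • M ν) =
    ∑ μ, (z - c μ)⁻¹ • schlesRhs c M ν μ := by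
  have hfil : Finset.univ.filter (fun κ => κ ≠ ν) = Finset.univ.erase ν := by
    ext; simp
  rw [Finset.mul_sum, Finset.sum_mul, ← Finset.sum_sub_distrib,
    ← Finset.add_sum_erase _ _ (Finset.mem_univ ν),
    ← Finset.add_sum_erase Finset.univ (fun μ => (z - c μ)⁻¹ • schlesRhs c M ν μ)
      (Finset.mem_univ ν)]
  have h0 : schlesRhs c M ν ν = -∑ κ ∈ Finset.univ.erase ν,
      (c ν - c κ)⁻¹ • (M ν * M κ - M κ * M ν) := by
    rw [schlesRhs, if_pos rfl, hfil]
  rw [h0, ← Finset.sum_neg_distrib, Finset.smul_sum, ← Finset.sum_add_distrib]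
  have h1 : (-(z - c ν)⁻¹) • M ν * ((z - c ν)⁻¹ • M ν) -
      (z - c ν)⁻¹ • M ν * ((-(z - c ν)⁻¹) • M ν) = 0 := by
    simp [smul_smul]
  rw [h1, zero_add]
  refine Finset.sum_congr rfl fun μ hμ => ?_
  have hne := Finset.ne_of_mem_erase hμ
  rw [schlesRhs, if_neg hne]
  have a1 : z - c ν ≠ 0 := sub_ne_zero.2 (hz ν)
  have a2 : z - c μ ≠ 0 := sub_ne_zero.2 (hz μ)
  have a3 : c μ - c ν ≠ 0 := sub_ne_zero.2 (hc _ _ hne)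
  have a4 : (c ν - c μ)⁻¹ = -(c μ - c ν)⁻¹ := by rw [← inv_neg, neg_sub]
  have key : (z - c ν)⁻¹ * (z - c μ)⁻¹ =
      (z - c μ)⁻¹ * (c μ - c ν)⁻¹ - (z - c ν)⁻¹ * (c μ - c ν)⁻¹ := by
    field_simp
    ring
  rw [a4]
  simp only [Matrix.smul_mul, Matrix.mul_smul]
  generalize M ν * M μ = P
  generalize M μ * M ν = Q
  ext i j
  simp only [Matrix.sub_apply, Matrix.add_apply, Matrix.neg_apply, Matrix.smul_apply, smul_eq_mul]
  linear_combination (Q i j - P i j) * key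

theorem fderiv_lax {N r : ℕ} (c : Fin N → ℂ)
    (L : Fin N → (Fin N → ℂ) → Matrix (Fin r) (Fin r) ℂ)
    (hL : ∀ μ : Fin N, DifferentiableAt ℂ (L μ) c) (ν : Fin N) (z : ℂ) (hz : ∀ μ, z ≠ c μ) :
    fderiv ℂ (fun c' : Fin N → ℂ => ∑ μ : Fin N, (z - c' μ)⁻¹ • L μ c') c (Pi.single ν 1) =
      (z - c ν)⁻¹ ^ 2 • L ν c + ∑ μ, (z - c μ)⁻¹ • fderiv ℂ (L μ) c (Pi.single ν 1) := by
  have hg : ∀ μ, HasFDerivAt (fun c' : Fin N → ℂ => (z - c' μ)⁻¹)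
      (((z - c μ)⁻¹ ^ 2) • (ContinuousLinearMap.proj μ : (Fin N → ℂ) →L[ℂ] ℂ)) c := by
    intro μ
    have a2 : z - c μ ≠ 0 := sub_ne_zero.2 (hz μ)
    have h1 : HasFDerivAt (fun c' : Fin N → ℂ => c' μ)
      (ContinuousLinearMap.proj μ : (Fin N → ℂ) →L[ℂ] ℂ) c := hasFDerivAt_apply μ c
    have h2 : HasDerivAt (fun w : ℂ => (z - w)⁻¹) ((z - c μ)⁻¹ ^ 2) (c μ) := by
      have h3 := ((hasDerivAt_id (c μ)).const_sub z).inv a2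
      have h4 : (z - c μ)⁻¹ ^ 2 = -(-1) / (z - id (c μ)) ^ 2 := by
        simp
      rw [h4]
      exact h3
    exact HasDerivAt.comp_hasFDerivAt (h₂ := fun w : ℂ => (z - w)⁻¹)
      (f := fun c' : Fin N → ℂ => c' μ) c h2 h1
  have h := HasFDerivAt.fun_sum (u := Finset.univ)
    fun μ _ => (hg μ).smul (hL μ).hasFDerivAt
  have h' := h.fderiv
  refine (congrArg (fun T => T (Pi.single ν 1)) h').trans ?_
  simp only [ContinuousLinearMap.sum_apply, ContinuousLinearMap.add_apply,
    ContinuousLinearMap.smul_apply, ContinuousLinearMap.smulRight_apply,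
    ContinuousLinearMap.proj_apply, Finset.sum_add_distrib]
  rw [add_comm]
  congr 1
  rw [Finset.sum_eq_single ν]
  · simp
  · intro b _ hb
    simp [Pi.single_eq_of_ne hb]
  · simp

/-- The nonautonomous Hamiltonian form of the Schlesinger system: the equations
`∂_{c_ν} A(z,c) = (z − c_ν)⁻² • L^ν + [−(z − c_ν)⁻¹ • L^ν, A(z,c)]` for the Fuchsian
Lax matrix `A(z,c) = Σ_μ (z − c_μ)⁻¹ • L^μ(c)` are equivalent to the Schlesinger
equations for the residue matrices `L^μ`. -/
theorem schlesinger_iff_hamiltonian_form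
    (N r : ℕ) (hN : 1 ≤ N) (hr : 1 ≤ r)
    (Ω : Set (Fin N → ℂ)) (hΩ : IsOpen Ω)
    (hdist : ∀ c ∈ Ω, ∀ i j : Fin N, i ≠ j → c i ≠ c j)
    (L : Fin N → (Fin N → ℂ) → Matrix (Fin r) (Fin r) ℂ)
    (hL : ∀ μ : Fin N, DifferentiableOn ℂ (L μ) Ω) :
    (∀ ν : Fin N, ∀ c ∈ Ω, ∀ z : ℂ, (∀ μ : Fin N, z ≠ c μ) →
        fderiv ℂ (fun c' : Fin N → ℂ => ∑ μ : Fin N, (z - c' μ)⁻¹ • L μ c') c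
            (Pi.single ν 1) =
          (z - c ν)⁻¹ ^ 2 • L ν c +
            (((-(z - c ν)⁻¹) • L ν c) * (∑ μ : Fin N, (z - c μ)⁻¹ • L μ c) -
              (∑ μ : Fin N, (z - c μ)⁻¹ • L μ c) * ((-(z - c ν)⁻¹) • L ν c)))
      ↔
    (∀ c ∈ Ω,
      (∀ μ ν : Fin N, μ ≠ ν →
        fderiv ℂ (L μ) c (Pi.single ν 1) =
          (c μ - c ν)⁻¹ • (L μ c * L ν c - L ν c * L μ c)) ∧
      (∀ μ : Fin N,
        fderiv ℂ (L μ) c (Pi.single μ 1) =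
          -∑ ν ∈ Finset.univ.filter (fun ν => ν ≠ μ),
            (c μ - c ν)⁻¹ • (L μ c * L ν c - L ν c * L μ c))) := by
  have hd : ∀ c ∈ Ω, ∀ μ, DifferentiableAt ℂ (L μ) c := fun c hc μ =>
    (hL μ).differentiableAt (hΩ.mem_nhds hc)
  constructor
  · intro h c hc
    have key : ∀ ν μ, fderiv ℂ (L μ) c (Pi.single ν 1) = schlesRhs c (fun κ => L κ c) ν μ := by
      intro ν
      refine cauchy_indep c (hdist c hc) _ _ fun z hz => ?_
      have h1 := h ν c hc z hz
      rw [fderiv_lax c L (hd c hc) ν z hz,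
        commutator_eq c (hdist c hc) (fun κ => L κ c) ν z hz] at h1
      exact add_left_cancel h1
    refine ⟨fun μ ν hne => ?_, fun μ => ?_⟩
    · rw [key, schlesRhs, if_neg hne]
    · rw [key, schlesRhs, if_pos rfl]
  · intro h ν c hc z hz
    rw [fderiv_lax c L (hd c hc) ν z hz,
      commutator_eq c (hdist c hc) (fun κ => L κ c) ν z hz]
    congr 1
    refine Finset.sum_congr rfl fun μ _ => ?_
    congr 1
    by_cases hne : μ = ν
    · subst hne
      rw [(h c hc).2, schlesRhs, if_pos rfl]
    · rw [(h c hc).1 μ ν hne, schlesRhs, if_neg hne]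
end

section
/- With the notation and hypotheses of the Schlesinger setting (N ≥ 1, r ≥ 1, Ω ⊆ ℂ^N the open set of pairwise distinct tuples, L¹,…,L^N : Ω → Matrix (Fin r) (Fin r) ℂ differentiable), assume the Schlesinger equations hold: for all μ ≠ ν, ∂_{c_ν} L^μ = (c_μ − c_ν)⁻¹ • (L^μ L^ν − L^ν L^μ), and ∂_{c_μ} L^μ = − Σ_{ν ≠ μ} (c_μ − c_ν)⁻¹ • (L^μ L^ν − L^ν L^μ). Then for all μ ≠ ν, all c ∈ Ω and all z ∉ {c₁,…,c_N}: ∂_{c_μ}[ (z − c_ν)⁻¹ • L^ν(c) ] − ∂_{c_ν}[ (z − c_μ)⁻¹ • L^μ(c) ] + [ (z − c_μ)⁻¹ • L^μ(c), (z − c_ν)⁻¹ • L^ν(c) ] = 0, i.e. the mixed zero-curvature equations hold. -/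
open Matrix

attribute [local instance] Matrix.normedAddCommGroup Matrix.normedSpace

/-- The Schlesinger equations imply the mixed zero-curvature equations
`∂_{c_μ}[(z−c_ν)⁻¹ L^ν] − ∂_{c_ν}[(z−c_μ)⁻¹ L^μ] + [(z−c_μ)⁻¹ L^μ, (z−c_ν)⁻¹ L^ν] = 0`. -/
theorem schlesinger_mixed_zero_curvature
    (N r : ℕ) (hN : 1 ≤ N) (hr : 1 ≤ r)
    (Ω : Set (Fin N → ℂ)) (hΩ : IsOpen Ω)
    (hdist : ∀ c ∈ Ω, ∀ i j : Fin N, i ≠ j → c i ≠ c j)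
    (L : Fin N → (Fin N → ℂ) → Matrix (Fin r) (Fin r) ℂ)
    (hL : ∀ μ : Fin N, DifferentiableOn ℂ (L μ) Ω)
    (hSch₁ : ∀ c ∈ Ω, ∀ μ ν : Fin N, μ ≠ ν →
      fderiv ℂ (L μ) c (Pi.single ν 1) =
        (c μ - c ν)⁻¹ • (L μ c * L ν c - L ν c * L μ c))
    (hSch₂ : ∀ c ∈ Ω, ∀ μ : Fin N,
      fderiv ℂ (L μ) c (Pi.single μ 1) =
        -∑ ν ∈ Finset.univ.filter (fun ν => ν ≠ μ),
          (c μ - c ν)⁻¹ • (L μ c * L ν c - L ν c * L μ c)) :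
    ∀ μ ν : Fin N, μ ≠ ν → ∀ c ∈ Ω, ∀ z : ℂ, (∀ i : Fin N, z ≠ c i) →
      fderiv ℂ (fun c' : Fin N → ℂ => (z - c' ν)⁻¹ • L ν c') c (Pi.single μ 1) -
        fderiv ℂ (fun c' : Fin N → ℂ => (z - c' μ)⁻¹ • L μ c') c (Pi.single ν 1) +
        (((z - c μ)⁻¹ • L μ c) * ((z - c ν)⁻¹ • L ν c) -
          ((z - c ν)⁻¹ • L ν c) * ((z - c μ)⁻¹ • L μ c)) = 0 := by
  have key : ∀ μ ν : Fin N, μ ≠ ν → ∀ c ∈ Ω, ∀ z : ℂ, (∀ i : Fin N, z ≠ c i) →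
      fderiv ℂ (fun c' : Fin N → ℂ => (z - c' μ)⁻¹ • L μ c') c (Pi.single ν 1) =
        (z - c μ)⁻¹ • ((c μ - c ν)⁻¹ • (L μ c * L ν c - L ν c * L μ c)) := by
    intro μ ν hμν c hc z hz
    have hzμ : z - c μ ≠ 0 := sub_ne_zero.mpr (hz μ)
    have hLd : HasFDerivAt (L μ) (fderiv ℂ (L μ) c) c :=
      ((hL μ).differentiableAt (hΩ.mem_nhds hc)).hasFDerivAt
    have hp : HasFDerivAt (fun c' : Fin N → ℂ => z - c' μ)
        (-(ContinuousLinearMap.proj (R := ℂ) (φ := fun _ : Fin N => ℂ) μ)) c :=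
      (hasFDerivAt_apply μ c).const_sub z
    have hi := (hasDerivAt_inv hzμ).comp_hasFDerivAt c hp
    have h := hi.smul hLd
    have h2 := h.fderiv
    have h3 : fderiv ℂ (fun c' : Fin N → ℂ => (z - c' μ)⁻¹ • L μ c') c = _ := h2
    rw [h3, ← hSch₁ c hc μ ν hμν]
    change (z - c μ)⁻¹ • fderiv ℂ (L μ) c (Pi.single ν 1) +
      (-((z - c μ) ^ 2)⁻¹ * -((Pi.single ν 1 : Fin N → ℂ) μ)) • L μ c = _
    rw [Pi.single_eq_of_ne hμν, neg_zero, mul_zero, zero_smul, add_zero]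
  intro μ ν hμν c hc z hz
  rw [key ν μ hμν.symm c hc z hz, key μ ν hμν c hc z hz]
  have h1 : z - c μ ≠ 0 := sub_ne_zero.mpr (hz μ)
  have h2 : z - c ν ≠ 0 := sub_ne_zero.mpr (hz ν)
  have h3 : c μ - c ν ≠ 0 := sub_ne_zero.mpr (hdist c hc μ ν hμν)
  have h4 : c ν - c μ ≠ 0 := sub_ne_zero.mpr (hdist c hc ν μ hμν.symm)
  have e : (z - c ν)⁻¹ * (c ν - c μ)⁻¹ + (z - c μ)⁻¹ * (c μ - c ν)⁻¹
      = (z - c μ)⁻¹ * (z - c ν)⁻¹ := by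
    have : (c ν - c μ)⁻¹ = -(c μ - c ν)⁻¹ := by rw [← inv_neg, neg_sub]
    rw [this]
    field_simp
    ring
  simp only [smul_mul_assoc, mul_smul_comm, smul_smul]
  rw [mul_comm (z - c ν)⁻¹ (z - c μ)⁻¹, ← e]
  module
end

section
/- Let K be a field, r ≥ 1, and let l, q, p : Fin r → K with l injective. Set L := diagonal(l), Q₁ := diagonal(q), Q₂ := diagonal(p) (diagonal matrices with the given diagonal entries). Let M, X, Y be r×r matrices over K satisfying L·X − X·L = M·Q₂ − Q₂·M and L·Y − Y·L = M·Q₁ − Q₁·M. Then X·Q₁ − Q₁·X = Y·Q₂ − Q₂·Y. -/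
open Matrix

/-- The symmetric commutator identity `[ad_L⁻¹[M,Q₂], Q₁] = [ad_L⁻¹[M,Q₁], Q₂]` for
diagonal matrices `Q₁, Q₂` in the commutant of an ad-regular diagonal matrix `L`:
if `L X − X L = M Q₂ − Q₂ M` and `L Y − Y L = M Q₁ − Q₁ M`, then
`X Q₁ − Q₁ X = Y Q₂ − Q₂ Y`. -/
theorem symmetric_commutator_identity
    {K : Type*} [Field K] (r : ℕ) (hr : 1 ≤ r)
    (l q p : Fin r → K) (hl : Function.Injective l)
    (M X Y : Matrix (Fin r) (Fin r) K)
    (hX : Matrix.diagonal l * X - X * Matrix.diagonal l =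
      M * Matrix.diagonal p - Matrix.diagonal p * M)
    (hY : Matrix.diagonal l * Y - Y * Matrix.diagonal l =
      M * Matrix.diagonal q - Matrix.diagonal q * M) :
    X * Matrix.diagonal q - Matrix.diagonal q * X =
      Y * Matrix.diagonal p - Matrix.diagonal p * Y := by
  ext i j
  have h1 := congrFun (congrFun hX i) j
  have h2 := congrFun (congrFun hY i) j
  simp only [Matrix.sub_apply, Matrix.diagonal_mul, Matrix.mul_diagonal] at h1 h2 ⊢
  by_cases hij : i = j
  · subst hij
    ring
  · have hne : l i - l j ≠ 0 := sub_ne_zero.mpr (fun h => hij (hl h))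
    apply mul_left_cancel₀ hne
    linear_combination (q j - q i) * h1 - (p j - p i) * h2
end

section
/- Fix integers r ≥ 1 and d ≥ 0. Let A be an r×r matrix of formal Laurent series over ℂ whose entries all have order ≥ −(d+1); for j ∈ ℤ write A_j ∈ M_r(ℂ) for the matrix of ζ^j-coefficients, and assume the leading coefficient A_{−(d+1)} is a diagonal matrix with pairwise distinct diagonal entries. Then there exists a unique pair (F, Λ) with: F an r×r matrix of formal power series over ℂ whose constant coefficient matrix is the identity and whose coefficient matrices F_ℓ for every ℓ ≥ 1 have all diagonal entries zero; Λ an r×r diagonal matrix of formal Laurent series whose entries have order ≥ −(d+1); such that A · F = F · Λ as matrices over the field of formal Laurent series. -/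
open Matrix

theorem ps_fixed_point {ι : Type*} (T : (ι → PowerSeries ℂ) → (ι → PowerSeries ℂ))
    (hT : ∀ (n : ℕ) (v w : ι → PowerSeries ℂ), (∀ i, PowerSeries.X ^ n ∣ v i - w i) →
      ∀ i, PowerSeries.X ^ (n + 1) ∣ T v i - T w i) :
    ∃! v, T v = v := by
  have hzero : ∀ v w : ι → PowerSeries ℂ,
      (∀ n : ℕ, ∀ i, PowerSeries.X ^ n ∣ v i - w i) → v = w := by
    intro v w h
    funext i
    ext m
    have := (PowerSeries.X_pow_dvd_iff.1 (h (m + 1) i)) m (Nat.lt_succ_self m)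
    rw [map_sub] at this
    exact sub_eq_zero.1 this
  have hstep : ∀ n : ℕ, ∀ i, PowerSeries.X ^ n ∣ T^[n + 1] 0 i - T^[n] 0 i := by
    intro n
    induction n with
    | zero => intro i; simp
    | succ n ih =>
      intro i
      rw [Function.iterate_succ_apply' T (n + 1), Function.iterate_succ_apply' T n]
      apply hT
      intro j
      have := ih j
      rwa [Function.iterate_succ_apply' T n] at this
  have hcauchy : ∀ n k : ℕ, ∀ i, PowerSeries.X ^ n ∣ T^[n + k] 0 i - T^[n] 0 i := by
    intro n k
    induction k with
    | zero => intro i; simp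
    | succ k ih =>
      intro i
      have h1 := (pow_dvd_pow (PowerSeries.X : PowerSeries ℂ) (Nat.le_add_right n k)).trans
        (hstep (n + k) i)
      have := dvd_add h1 (ih i)
      simpa [add_assoc] using this
  let L : ι → PowerSeries ℂ :=
    fun i => PowerSeries.mk fun m => PowerSeries.coeff m (T^[m + 1] 0 i)
  have hL : ∀ n : ℕ, ∀ i, PowerSeries.X ^ n ∣ L i - T^[n] 0 i := by
    intro n i
    rw [PowerSeries.X_pow_dvd_iff]
    intro m hm
    obtain ⟨k, rfl⟩ := Nat.exists_eq_add_of_le (Nat.succ_le_of_lt hm)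
    have := (PowerSeries.X_pow_dvd_iff.1 (hcauchy (m + 1) k i)) m (Nat.lt_succ_self m)
    rw [map_sub, sub_eq_zero] at this
    simp only [L, map_sub, PowerSeries.coeff_mk]
    rw [sub_eq_zero]
    exact this.symm
  refine ⟨L, ?_, ?_⟩
  · apply hzero
    intro n i
    have h1 := hT n L (T^[n] 0) (hL n) i
    rw [← Function.iterate_succ_apply' T n] at h1
    have h2 := dvd_sub h1 (hL (n + 1) i)
    have h3 := (pow_dvd_pow (PowerSeries.X : PowerSeries ℂ) (Nat.le_succ n)).trans h2
    simpa using h3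
  · intro w hw
    apply hzero
    intro n
    induction n with
    | zero => intro i; simp
    | succ n ih =>
      intro i
      have := hT n w L ih i
      rw [hw] at this
      have h1 := hT n L (T^[n] 0) (hL n) i
      rw [← Function.iterate_succ_apply' T n] at h1
      have h2 := dvd_sub h1 (hL (n + 1) i)
      have h3 := dvd_add this h2
      simpa using h3

open PowerSeries in
theorem ps_column {r : ℕ} (k : Fin r) (a : Fin r → Fin r → PowerSeries ℂ)
    (h0 : ∀ i j, i ≠ j → constantCoeff (a i j) = 0)
    (hs : ∀ i j, i ≠ j → constantCoeff (a i i) ≠ constantCoeff (a j j)) :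
    ∃! v : Fin r → PowerSeries ℂ, v k = 1 ∧ (∀ i, i ≠ k → constantCoeff (v i) = 0) ∧
      ∀ i, ∑ j, a i j * v j = v i * ∑ j, a k j * v j := by
  have hb : ∀ i j, ∃ b, a i j = C (constantCoeff (a i j)) + X * b := by
    intro i j
    have : X ∣ a i j - C (constantCoeff (a i j)) := by
      rw [X_dvd_iff]; simp
    obtain ⟨b, hb⟩ := this
    exact ⟨b, by rw [← hb]; ring⟩
  choose b hb using hb
  let e : Fin r → PowerSeries ℂ := fun j => if j = k then 1 else 0
  let V : (Fin r → PowerSeries ℂ) → (Fin r → PowerSeries ℂ) := fun u j => e j + X * u j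
  let c : Fin r → ℂ := fun i => constantCoeff (a i i)
  -- the sums split
  have hsum : ∀ i (v : Fin r → PowerSeries ℂ),
      ∑ j, a i j * v j = C (c i) * v i + X * ∑ j, b i j * v j := by
    intro i v
    have : ∀ j, a i j * v j = (if j = i then C (c i) * v i else 0) + X * (b i j * v j) := by
      intro j
      conv_lhs => rw [hb i j]
      split_ifs with h
      · subst h; simp only [c]; ring
      · rw [h0 i j (Ne.symm h)]; simp; ring
    simp only [this]
    rw [Finset.sum_add_distrib, ← Finset.mul_sum]
    simp
  let T : (Fin r → PowerSeries ℂ) → (Fin r → PowerSeries ℂ) := fun u i =>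
    C ((c k - c i)⁻¹) * (∑ j, b i j * V u j - X * u i * ∑ j, b k j * V u j)
  have hT : ∀ (n : ℕ) (v w : Fin r → PowerSeries ℂ), (∀ i, X ^ n ∣ v i - w i) →
      ∀ i, X ^ (n + 1) ∣ T v i - T w i := by
    intro n v w h i
    have h1 : ∀ j, X ^ (n + 1) ∣ X * v j - X * w j := by
      intro j
      rw [← mul_sub, pow_succ']
      exact mul_dvd_mul_left _ (h j)
    have h2 : ∀ i, X ^ (n + 1) ∣ ∑ j, b i j * V v j - ∑ j, b i j * V w j := by
      intro i
      rw [← Finset.sum_sub_distrib]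
      apply Finset.dvd_sum
      intro j _
      rw [← mul_sub]
      apply Dvd.dvd.mul_left
      simpa [V] using h1 j
    have h3 : T v i - T w i = C ((c k - c i)⁻¹) *
        ((∑ j, b i j * V v j - ∑ j, b i j * V w j)
          - (X * v i * (∑ j, b k j * V v j - ∑ j, b k j * V w j)
            + (∑ j, b k j * V w j) * (X * v i - X * w i))) := by
      simp only [T]; ring
    rw [h3]
    apply Dvd.dvd.mul_left
    exact dvd_sub (h2 i) (dvd_add ((h2 k).mul_left _) ((h1 i).mul_left _))
  have hek : e k = 1 := by simp [e]
  have hei : ∀ i, i ≠ k → e i = 0 := fun i hi => by simp [e, hi]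
  -- characterization
  have hchar : ∀ u : Fin r → PowerSeries ℂ, T u = u ↔ (V u k = 1 ∧
      ∀ i, ∑ j, a i j * V u j = V u i * ∑ j, a k j * V u j) := by
    intro u
    constructor
    · intro hu
      have huk : u k = 0 := by rw [← hu]; simp [T]
      have hVk : V u k = 1 := by simp [V, huk, hek]
      refine ⟨hVk, fun i => ?_⟩
      by_cases hi : i = k
      · subst hi; rw [hVk, one_mul]
      · have hui : C (c k - c i) * u i =
            (∑ j, b i j * V u j - X * u i * ∑ j, b k j * V u j) := by
          conv_lhs => rw [← hu]
          simp only [T]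
          rw [← mul_assoc, ← map_mul, mul_inv_cancel₀ (sub_ne_zero.2 (hs k i (Ne.symm hi)))]
          simp
        have hVi : V u i = X * u i := by simp [V, hei i hi]
        rw [hsum, hsum, hVk, hVi]
        rw [map_sub] at hui
        linear_combination (-X) * hui
    · rintro ⟨hVk, hE⟩
      have huk : u k = 0 := by
        simpa [V, hek] using hVk
      funext i
      by_cases hi : i = k
      · subst hi; rw [huk]; simp [T]
      · have hVi : V u i = X * u i := by simp [V, hei i hi]
        have h := hE i
        rw [hsum, hsum, hVk, hVi] at h
        have hui : C (c k - c i) * u i =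
            (∑ j, b i j * V u j - X * u i * ∑ j, b k j * V u j) := by
          apply mul_left_cancel₀ (X_ne_zero (R := ℂ))
          rw [map_sub]
          linear_combination -h
        simp only [T]
        rw [← hui, ← mul_assoc, ← map_mul, inv_mul_cancel₀ (sub_ne_zero.2 (hs k i (Ne.symm hi)))]
        simp
  obtain ⟨u, hu, huniq⟩ := ps_fixed_point T hT
  refine ⟨V u, ⟨((hchar u).1 hu).1, ?_, ((hchar u).1 hu).2⟩, ?_⟩
  · intro i hi
    simp [V, hei i hi]
  · rintro w ⟨hw1, hw2, hw3⟩
    have : ∀ i, ∃ x, w i = e i + X * x := by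
      intro i
      by_cases hi : i = k
      · subst hi; exact ⟨0, by simp [hw1, hek]⟩
      · obtain ⟨x, hx⟩ := X_dvd_iff.2 (hw2 i hi)
        exact ⟨x, by rw [hx, hei i hi, zero_add]⟩
    choose x hx using this
    have hwV : w = V x := funext hx
    rw [hwV] at hw1 hw3 ⊢
    rw [huniq x ((hchar x).2 ⟨hw1, hw3⟩)]

theorem laurent_lift (f : LaurentSeries ℂ) (h : ∀ n : ℤ, n < 0 → f.coeff n = 0) :
    ∃ g : PowerSeries ℂ, HahnSeries.ofPowerSeries ℤ ℂ g = f := by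
  refine ⟨PowerSeries.mk fun n => f.coeff n, ?_⟩
  ext n
  rw [PowerSeries.coeff_coe]
  split_ifs with hn
  · rw [h n hn]
  · rw [PowerSeries.coeff_mk]
    congr 1
    omega

theorem laurent_lift_shift (N : ℤ) (f : LaurentSeries ℂ) (h : ∀ n : ℤ, n < N → f.coeff n = 0) :
    ∃ g : PowerSeries ℂ, f = HahnSeries.single N 1 * HahnSeries.ofPowerSeries ℤ ℂ g := by
  obtain ⟨g, hg⟩ := laurent_lift (HahnSeries.single (-N) (1 : ℂ) * f) (by
    intro n hn
    rw [HahnSeries.coeff_single_mul, h _ (by omega), mul_zero])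
  refine ⟨g, ?_⟩
  rw [hg, ← mul_assoc, HahnSeries.single_mul_single]
  simp


/-- Formal diagonalization of a matrix of Laurent series at a nonresonant irregular
singular point: if all entries of `A` have order `≥ −(d+1)` and the leading coefficient
`A_{−(d+1)}` is diagonal with pairwise distinct entries, there is a unique pair `(F, Λ)`
with `F` a power-series matrix with constant term the identity and diagonal-free higher
coefficients, `Λ` diagonal with entries of order `≥ −(d+1)`, and `A·F = F·Λ`. -/
theorem formal_diagonalization_exists_unique
    (r d : ℕ) (hr : 1 ≤ r)
    (A : Matrix (Fin r) (Fin r) (LaurentSeries ℂ))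
    (hord : ∀ i k : Fin r, ∀ n : ℤ, n < -(d + 1 : ℤ) → (A i k).coeff n = 0)
    (hdiag : ∀ i k : Fin r, i ≠ k → (A i k).coeff (-(d + 1 : ℤ)) = 0)
    (hsep : ∀ i k : Fin r, i ≠ k →
      (A i i).coeff (-(d + 1 : ℤ)) ≠ (A k k).coeff (-(d + 1 : ℤ))) :
    ∃! FΛ : Matrix (Fin r) (Fin r) (LaurentSeries ℂ) ×
        Matrix (Fin r) (Fin r) (LaurentSeries ℂ),
      (∀ i k : Fin r, ∀ n : ℤ, n < 0 → (FΛ.1 i k).coeff n = 0) ∧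
      (∀ i k : Fin r, (FΛ.1 i k).coeff 0 = if i = k then 1 else 0) ∧
      (∀ i : Fin r, ∀ n : ℤ, 1 ≤ n → (FΛ.1 i i).coeff n = 0) ∧
      (∀ i k : Fin r, i ≠ k → FΛ.2 i k = 0) ∧
      (∀ i : Fin r, ∀ n : ℤ, n < -(d + 1 : ℤ) → (FΛ.2 i i).coeff n = 0) ∧
      A * FΛ.1 = FΛ.1 * FΛ.2 := by

  have hN : ∃ N : ℤ, N = -(d + 1 : ℤ) := ⟨_, rfl⟩
  obtain ⟨N, hN⟩ := hN
  rw [← hN] at hord hdiag hsep ⊢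
  let φ := HahnSeries.ofPowerSeries ℤ ℂ
  have hφ : Function.Injective φ := HahnSeries.ofPowerSeries_injective
  have hφ0 : ∀ g : PowerSeries ℂ, (φ g).coeff 0 = PowerSeries.constantCoeff g := by
    intro g
    have := PowerSeries.coeff_coe g 0
    simpa using this
  have hφneg : ∀ (g : PowerSeries ℂ) (n : ℤ), n < 0 → (φ g).coeff n = 0 := by
    intro g n hn
    have := PowerSeries.coeff_coe g n
    rwa [if_pos hn] at this
  let S : LaurentSeries ℂ := HahnSeries.single N 1
  have hS : S ≠ 0 := HahnSeries.single_ne_zero one_ne_zero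
  have hSco : ∀ (f : LaurentSeries ℂ) (n : ℤ), (S * f).coeff n = f.coeff (n - N) := by
    intro f n
    simp only [S]
    rw [HahnSeries.coeff_single_mul, one_mul]
  have ha : ∀ i k, ∃ g, A i k = S * φ g := fun i k => laurent_lift_shift N (A i k) (hord i k)
  choose a ha using ha
  have haN : ∀ i k, (A i k).coeff N = PowerSeries.constantCoeff (a i k) := by
    intro i k
    rw [ha, hSco, sub_self, hφ0]
  have h0 : ∀ i j, i ≠ j → PowerSeries.constantCoeff (a i j) = 0 := by
    intro i j hij
    rw [← haN]; exact hdiag i j hij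
  have hs : ∀ i j, i ≠ j →
      PowerSeries.constantCoeff (a i i) ≠ PowerSeries.constantCoeff (a j j) := by
    intro i j hij
    rw [← haN, ← haN]; exact hsep i j hij
  have hAsum : ∀ i (v : Fin r → PowerSeries ℂ),
      ∑ j, A i j * φ (v j) = S * φ (∑ j, a i j * v j) := by
    intro i v
    rw [map_sum, Finset.mul_sum]
    refine Finset.sum_congr rfl fun j _ => ?_
    rw [ha, map_mul, mul_assoc]
  choose v hv huniq using fun k => ps_column k a h0 hs
  have hmuldiag : ∀ (F L : Matrix (Fin r) (Fin r) (LaurentSeries ℂ)),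
      (∀ i k, i ≠ k → L i k = 0) → ∀ i k, (F * L) i k = F i k * L k k := by
    intro F L hL i k
    rw [Matrix.mul_apply]
    refine Finset.sum_eq_single k (fun j _ hj => ?_) (by simp)
    rw [hL j k hj, mul_zero]
  let F : Matrix (Fin r) (Fin r) (LaurentSeries ℂ) := Matrix.of fun i k => φ (v k i)
  let L : Matrix (Fin r) (Fin r) (LaurentSeries ℂ) :=
    Matrix.of fun i k => if i = k then S * φ (∑ j, a k j * v k j) else 0
  have hLoff : ∀ i k, i ≠ k → L i k = 0 := fun i k h => by simp [L, h]
  have hLd : ∀ k, L k k = S * φ (∑ j, a k j * v k j) := fun k => by simp [L]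
  refine ⟨(F, L), ⟨?_, ?_, ?_, hLoff, ?_, ?_⟩, ?_⟩
  · intro i k n hn
    exact hφneg _ n hn
  · intro i k
    change (φ (v k i)).coeff 0 = _
    rw [hφ0]
    split_ifs with h
    · subst h; rw [(hv i).1]; simp
    · exact (hv k).2.1 i h
  · intro i n hn
    change (φ (v i i)).coeff n = 0
    rw [(hv i).1, map_one, HahnSeries.coeff_one, if_neg (by omega)]
  · intro i n hn
    change (L i i).coeff n = 0
    rw [hLd, hSco, hφneg _ _ (by omega)]
  · ext1 i k
    change (A * F) i k = (F * L) i k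
    rw [hmuldiag F L hLoff, hLd, Matrix.mul_apply]
    change ∑ j, A i j * φ (v k j) = φ (v k i) * _
    rw [hAsum, (hv k).2.2 i, map_mul]
    ring
  · rintro ⟨G, M⟩ ⟨h1, h2, h3, h4, h5, h6⟩
    simp only at h1 h2 h3 h4 h5 h6
    have hg : ∀ k i, ∃ g, φ g = G i k := fun k i => laurent_lift (G i k) (h1 i k)
    choose g hg using hg
    have hGkk : ∀ k, G k k = 1 := by
      intro k
      ext n
      rcases lt_trichotomy n 0 with hn | hn | hn
      · rw [h1 k k n hn, HahnSeries.coeff_one, if_neg (by omega)]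
      · subst hn; rw [h2]; simp
      · rw [h3 k n (by omega), HahnSeries.coeff_one, if_neg (by omega)]
    have heq : ∀ i k, S * φ (∑ j, a i j * g k j) = G i k * M k k := by
      intro i k
      rw [← hmuldiag G M h4, ← h6, Matrix.mul_apply, ← hAsum]
      simp only [hg]
    have hM : ∀ k, M k k = S * φ (∑ j, a k j * g k j) := by
      intro k
      rw [heq, hGkk, one_mul]
    have hgv : ∀ k, g k = v k := by
      intro k
      apply huniq k
      refine ⟨?_, ?_, ?_⟩
      · apply hφ
        rw [hg, hGkk, map_one]
      · intro i hi
        rw [← hφ0, hg, h2, if_neg hi]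
      · intro i
        apply hφ
        apply mul_left_cancel₀ hS
        rw [heq, hM, map_mul, hg]
        ring
    have hGF : G = F := by
      ext1 i k
      change G i k = φ (v k i)
      rw [← hgv, hg]
    have hML : M = L := by
      ext1 i k
      by_cases hik : i = k
      · subst hik
        rw [hM, hLd, hgv]
      · rw [h4 i k hik, hLoff i k hik]
    rw [hGF, hML]
end

section
/- Fix integers r ≥ 1 and d ≥ 0. Let δ : Fin r → K, where K is the field of formal Laurent series over ℂ, be such that for all a ≠ b the order of δ_a − δ_b equals −(d+1). Let F be an r×r matrix over K whose diagonal entries are zero and whose off-diagonal entries all have order ≥ 0 (i.e. are formal power series). If λ ∈ K satisfies det( λ•1 − diagonal(δ) − F ) = 0, then there exists an index a such that either λ = δ_a or the order of λ − δ_a is at least d+1. -/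
open Matrix

/-- Eigenvalue perturbation lemma: if the diagonal entries `δ_a` are pairwise strongly
separated (all differences of exact order `−(d+1)`) and `F` is a diagonal-free matrix of
power series, then every root `λ` of `det(λ·1 − diagonal(δ) − F) = 0` agrees with some
diagonal entry `δ_a` to order `ζ^{d+1}`. -/
theorem eigenvalue_close_to_diagonal_entry
    (r d : ℕ) (hr : 1 ≤ r)
    (δ : Fin r → LaurentSeries ℂ)
    (hsep : ∀ a b : Fin r, a ≠ b →
      δ a - δ b ≠ 0 ∧ (δ a - δ b).order = -(d + 1 : ℤ))
    (F : Matrix (Fin r) (Fin r) (LaurentSeries ℂ))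
    (hFdiag : ∀ i : Fin r, F i i = 0)
    (hFord : ∀ i k : Fin r, ∀ n : ℤ, n < 0 → (F i k).coeff n = 0)
    (lam : LaurentSeries ℂ)
    (hdet : Matrix.det
      (lam • (1 : Matrix (Fin r) (Fin r) (LaurentSeries ℂ)) -
        Matrix.diagonal δ - F) = 0) :
    ∃ a : Fin r, lam = δ a ∨
      (lam - δ a ≠ 0 ∧ (d + 1 : ℤ) ≤ (lam - δ a).order) := by
  classical
  obtain ⟨v, hv0, hv⟩ := Matrix.exists_mulVec_eq_zero_iff.mpr hdet
  have hF : ∀ i k, ((0 : ℤ) : WithTop ℤ) ≤ HahnSeries.addVal ℤ ℂ (F i k) := by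
    intro i k
    rw [HahnSeries.addVal_apply]
    by_contra hlt
    have hne : F i k ≠ 0 := by
      intro h0
      simp [h0] at hlt
    rw [HahnSeries.orderTop_of_ne_zero hne, ← HahnSeries.order_of_ne hne] at hlt
    have hlt' : (F i k).order < 0 := by
      by_contra h
      exact hlt (WithTop.coe_le_coe.mpr (not_lt.mp h))
    exact hne (HahnSeries.coeff_order_eq_zero.mp (hFord i k _ hlt'))
  have heq : ∀ i, (lam - δ i) * v i = ∑ k, F i k * v k := by
    intro i
    have h := congrFun hv i
    simp only [Matrix.sub_mulVec, Matrix.smul_mulVec, Matrix.one_mulVec,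
      Matrix.mulVec_diagonal, Pi.sub_apply, Pi.smul_apply, smul_eq_mul, Pi.zero_apply] at h
    have h2 : (F *ᵥ v) i = ∑ k, F i k * v k := rfl
    rw [← h2]
    linear_combination h
  haveI : Nonempty (Fin r) := ⟨⟨0, hr⟩⟩
  obtain ⟨a, ha⟩ := Finite.exists_min (fun i => HahnSeries.addVal ℤ ℂ (v i))
  have hva : v a ≠ 0 := by
    intro h0
    apply hv0
    funext i
    have h1 := ha i
    simp only [h0, AddValuation.map_zero, top_le_iff] at h1
    exact (AddValuation.top_iff _).mp h1
  obtain ⟨m, hm⟩ : ∃ m : ℤ, HahnSeries.addVal ℤ ℂ (v a) = (m : WithTop ℤ) :=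
    ⟨_, HahnSeries.addVal_apply_of_ne hva⟩
  have hS : ∀ i, (m : WithTop ℤ) ≤ HahnSeries.addVal ℤ ℂ ((lam - δ i) * v i) := by
    intro i
    rw [heq]
    refine AddValuation.map_le_sum _ fun k _ => ?_
    have h1 := add_le_add (hF i k) (ha k)
    rw [AddValuation.map_mul]
    simpa [hm] using h1
  have hkey : ∀ (x y : LaurentSeries ℂ) (p q : ℤ),
      HahnSeries.addVal ℤ ℂ x = (p : WithTop ℤ) →
      (q : WithTop ℤ) ≤ HahnSeries.addVal ℤ ℂ (x * y) →
      ((q - p : ℤ) : WithTop ℤ) ≤ HahnSeries.addVal ℤ ℂ y := by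
    intro x y p q hx hxy
    rw [AddValuation.map_mul, hx] at hxy
    generalize HahnSeries.addVal ℤ ℂ y = t at hxy
    induction t using WithTop.recTopCoe with
    | top => exact le_top
    | coe t =>
      rw [← WithTop.coe_add, WithTop.coe_le_coe] at hxy
      rw [WithTop.coe_le_coe]
      omega
  have h0 : ((m - m : ℤ) : WithTop ℤ) ≤ HahnSeries.addVal ℤ ℂ (lam - δ a) :=
    hkey (v a) _ m m hm (by rw [mul_comm]; exact hS a)
  rw [sub_self] at h0
  have hb : ∀ b, b ≠ a →
      ((m - (-(d + 1 : ℤ)) : ℤ) : WithTop ℤ) ≤ HahnSeries.addVal ℤ ℂ (v b) := by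
    intro b hba
    refine hkey (lam - δ b) (v b) _ m ?_ (hS b)
    obtain ⟨hne, hord⟩ := hsep a b hba.symm
    have h1 : HahnSeries.addVal ℤ ℂ (δ a - δ b) = ((-(d + 1 : ℤ) : ℤ) : WithTop ℤ) := by
      rw [HahnSeries.addVal_apply_of_ne hne, hord]
    have h2 : HahnSeries.addVal ℤ ℂ (δ a - δ b) < HahnSeries.addVal ℤ ℂ (lam - δ a) := by
      rw [h1]
      refine lt_of_lt_of_le (WithTop.coe_lt_coe.mpr ?_) h0
      omega
    have h3 : lam - δ b = (δ a - δ b) + (lam - δ a) := by ring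
    rw [h3, ← h1]
    simp only [HahnSeries.addVal_apply] at h2 ⊢
    exact HahnSeries.orderTop_add_eq_left h2
  refine ⟨a, ?_⟩
  by_cases hl : lam = δ a
  · exact Or.inl hl
  have hne : lam - δ a ≠ 0 := sub_ne_zero.mpr hl
  refine Or.inr ⟨hne, ?_⟩
  have hfin := hkey (v a) (lam - δ a) m (m - (-(d + 1 : ℤ))) hm (by
    rw [mul_comm, heq]
    refine AddValuation.map_le_sum _ fun k _ => ?_
    by_cases hk : k = a
    · subst hk
      simp [hFdiag]
    · have h1 := add_le_add (hF a k) (hb k hk)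
      rw [AddValuation.map_mul]
      rwa [← WithTop.coe_add, zero_add] at h1)
  rw [HahnSeries.addVal_apply_of_ne hne, WithTop.coe_le_coe] at hfin
  omega
end

section
/- Fix integers r ≥ 1, d ≥ 0 and ℓ ≥ 0. Let A and B be two r×r matrices of formal Laurent series over ℂ, each with entries of order ≥ −(d+1) and with the same leading coefficient matrix A_{−(d+1)} = B_{−(d+1)}, assumed diagonal with pairwise distinct diagonal entries. Suppose the coefficient matrices of A and B agree in all degrees j with −(d+1) ≤ j ≤ −(d+1)+ℓ. Let (F, Λ) and (G, M) be the unique normalized formal diagonalizations of A and B respectively (F, G matrices of power series with constant coefficient the identity and all higher coefficients diagonal-free; Λ, M diagonal with entries of order ≥ −(d+1); A·F = F·Λ and B·G = G·M). Then the coefficient matrices of F and G agree in all degrees k ≤ ℓ, and the coefficient matrices of Λ and M agree in all degrees j ≤ −(d+1)+ℓ. -/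
open Matrix

/-- Leading coefficient of a product of Laurent series. -/
theorem coeff_mul_lead (x y : LaurentSeries ℂ) (p q : ℤ)
    (hx : ∀ n : ℤ, n < p → x.coeff n = 0) (hy : ∀ n : ℤ, n < q → y.coeff n = 0) :
    (x * y).coeff (p + q) = x.coeff p * y.coeff q := by
  rw [HahnSeries.coeff_mul]
  rw [Finset.sum_eq_single (p, q)]
  · rintro ⟨a, b⟩ hab hne
    rw [Finset.mem_antidiagonal] at hab
    obtain ⟨ha, hb, hs⟩ := hab
    simp only at ha hb hs
    have h1 : p ≤ a := by
      by_contra h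
      exact ha (hx a (by omega))
    have h2 : q ≤ b := by
      by_contra h
      exact hb (hy b (by omega))
    exact absurd (Prod.ext (by simp; omega) (by simp; omega)) hne
  · intro h
    rw [Finset.mem_antidiagonal] at h
    simp only [HahnSeries.mem_support, ne_eq, and_true, not_and, not_not] at h
    by_cases h0 : x.coeff p = 0
    · simp [h0]
    · simp [h h0]

/-- Leading coefficient of a matrix product. -/
theorem coeff_matrix_mul_lead {r : ℕ} (X Y : Matrix (Fin r) (Fin r) (LaurentSeries ℂ)) (p q : ℤ)
    (hx : ∀ i k, ∀ n : ℤ, n < p → (X i k).coeff n = 0)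
    (hy : ∀ i k, ∀ n : ℤ, n < q → (Y i k).coeff n = 0) (i k : Fin r) :
    ((X * Y) i k).coeff (p + q) = ∑ j, (X i j).coeff p * (Y j k).coeff q := by
  rw [Matrix.mul_apply, HahnSeries.coeff_sum]
  exact Finset.sum_congr rfl fun j _ => coeff_mul_lead _ _ _ _ (hx i j) (hy j k)

/-- Finite dependence of the formal diagonalization on the matrix coefficients
(the recursion (ratlp) of the paper): if `A` and `B` agree in degrees
`−(d+1), …, −(d+1)+ℓ`, their unique normalized formal diagonalizations `(F, Λ)`
and `(G, M)` agree in degrees `≤ ℓ` (for the eigenvector series) and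
`≤ −(d+1)+ℓ` (for the eigenvalue series). -/
theorem formal_diagonalization_finite_dependence
    (r d ℓ : ℕ) (hr : 1 ≤ r)
    (A B : Matrix (Fin r) (Fin r) (LaurentSeries ℂ))
    (hordA : ∀ i k : Fin r, ∀ n : ℤ, n < -(d + 1 : ℤ) → (A i k).coeff n = 0)
    (hordB : ∀ i k : Fin r, ∀ n : ℤ, n < -(d + 1 : ℤ) → (B i k).coeff n = 0)
    (hlead : ∀ i k : Fin r,
      (A i k).coeff (-(d + 1 : ℤ)) = (B i k).coeff (-(d + 1 : ℤ)))
    (hdiag : ∀ i k : Fin r, i ≠ k → (A i k).coeff (-(d + 1 : ℤ)) = 0)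
    (hsep : ∀ i k : Fin r, i ≠ k →
      (A i i).coeff (-(d + 1 : ℤ)) ≠ (A k k).coeff (-(d + 1 : ℤ)))
    (hagree : ∀ i k : Fin r, ∀ n : ℤ,
      -(d + 1 : ℤ) ≤ n → n ≤ -(d + 1 : ℤ) + ℓ → (A i k).coeff n = (B i k).coeff n)
    (F Λ G M : Matrix (Fin r) (Fin r) (LaurentSeries ℂ))
    (hF₁ : ∀ i k : Fin r, ∀ n : ℤ, n < 0 → (F i k).coeff n = 0)
    (hF₂ : ∀ i k : Fin r, (F i k).coeff 0 = if i = k then 1 else 0)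
    (hF₃ : ∀ i : Fin r, ∀ n : ℤ, 1 ≤ n → (F i i).coeff n = 0)
    (hΛ₁ : ∀ i k : Fin r, i ≠ k → Λ i k = 0)
    (hΛ₂ : ∀ i : Fin r, ∀ n : ℤ, n < -(d + 1 : ℤ) → (Λ i i).coeff n = 0)
    (hAF : A * F = F * Λ)
    (hG₁ : ∀ i k : Fin r, ∀ n : ℤ, n < 0 → (G i k).coeff n = 0)
    (hG₂ : ∀ i k : Fin r, (G i k).coeff 0 = if i = k then 1 else 0)
    (hG₃ : ∀ i : Fin r, ∀ n : ℤ, 1 ≤ n → (G i i).coeff n = 0)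
    (hM₁ : ∀ i k : Fin r, i ≠ k → M i k = 0)
    (hM₂ : ∀ i : Fin r, ∀ n : ℤ, n < -(d + 1 : ℤ) → (M i i).coeff n = 0)
    (hBG : B * G = G * M) :
    (∀ i k : Fin r, ∀ n : ℤ, n ≤ (ℓ : ℤ) → (F i k).coeff n = (G i k).coeff n) ∧
      (∀ i : Fin r, ∀ n : ℤ, n ≤ -(d + 1 : ℤ) + ℓ →
        (Λ i i).coeff n = (M i i).coeff n) := by
  generalize hN : (-(d + 1 : ℤ)) = N at *
  have hΛ₂' : ∀ i k, ∀ n : ℤ, n < N → (Λ i k).coeff n = 0 := by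
    intro i k n hn
    by_cases h : i = k
    · subst h; exact hΛ₂ i n hn
    · simp [hΛ₁ i k h]
  have hM₂' : ∀ i k, ∀ n : ℤ, n < N → (M i k).coeff n = 0 := by
    intro i k n hn
    by_cases h : i = k
    · subst h; exact hM₂ i n hn
    · simp [hM₁ i k h]
  -- leading eigenvalue
  have hΛlead : ∀ k, (Λ k k).coeff N = (A k k).coeff N := by
    intro k
    have h1 := coeff_matrix_mul_lead A F N 0 hordA hF₁ k k
    have h2 := coeff_matrix_mul_lead F Λ 0 N hF₁ hΛ₂' k k
    rw [hAF, add_comm, h2] at h1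
    simpa [hF₂] using h1
  have hid : (A - B) * F + B * (F - G) = (F - G) * Λ + G * (Λ - M) := by
    rw [Matrix.sub_mul, Matrix.mul_sub, Matrix.sub_mul, Matrix.mul_sub, hAF, hBG]
    abel
  have key : ∀ m : ℕ, m ≤ ℓ + 1 →
      (∀ i k, ∀ n : ℤ, n < (m : ℤ) → ((F - G) i k).coeff n = 0) ∧
      (∀ i k, ∀ n : ℤ, n < N + m → ((Λ - M) i k).coeff n = 0) := by
    intro m
    induction m with
    | zero =>
      intro _
      refine ⟨fun i k n hn => ?_, fun i k n hn => ?_⟩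
      · have hn' : n < 0 := by simpa using hn
        simp [hF₁ i k n hn', hG₁ i k n hn']
      · have hn' : n < N := by simpa using hn
        simp [hΛ₂' i k n hn', hM₂' i k n hn']
    | succ m ih =>
      intro hm
      obtain ⟨hD, hE⟩ := ih (by omega)
      have hC : ∀ i k, ∀ n : ℤ, n ≤ N + m → ((A - B) i k).coeff n = 0 := by
        intro i k n hn
        by_cases h : n < N
        · simp [hordA i k n h, hordB i k n h]
        · simp [hagree i k n (by omega) (by omega)]
      have hDd : ∀ i, ((F - G) i i).coeff (m : ℤ) = 0 := by
        intro i
        rcases Nat.eq_zero_or_pos m with h | h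
        · subst h; simp [hF₂, hG₂]
        · simp [hF₃ i m (by omega), hG₃ i m (by omega)]
      have heq : ∀ i k, (A i i).coeff N * ((F - G) i k).coeff (m : ℤ) =
          ((F - G) i k).coeff (m : ℤ) * (A k k).coeff N
            + (if i = k then ((Λ - M) k k).coeff (N + m) else 0) := by
        intro i k
        have h1 := coeff_matrix_mul_lead (A - B) F (N + m) 0
          (fun i k n hn => hC i k n hn.le) hF₁ i k
        have h2 := coeff_matrix_mul_lead B (F - G) N m hordB hD i k
        have h3 := coeff_matrix_mul_lead (F - G) Λ m N hD hΛ₂' i k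
        have h4 := coeff_matrix_mul_lead G (Λ - M) 0 (N + m) hG₁ hE i k
        rw [add_zero, Finset.sum_eq_zero (fun j _ => by rw [hC i j _ le_rfl, zero_mul])] at h1
        rw [Finset.sum_eq_single i (fun j _ hj => by
          rw [← hlead, hdiag i j (Ne.symm hj), zero_mul]) (by simp), ← hlead] at h2
        rw [add_comm, Finset.sum_eq_single k (fun j _ hj => by
          rw [hΛ₁ j k hj, HahnSeries.coeff_zero, mul_zero]) (by simp), hΛlead] at h3
        rw [zero_add, Finset.sum_eq_single i (fun j _ hj => by
          rw [hG₂, if_neg (Ne.symm hj), zero_mul]) (by simp), hG₂, if_pos rfl, one_mul] at h4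
        have h5 := congrArg (fun X : Matrix (Fin r) (Fin r) (LaurentSeries ℂ) =>
          (X i k).coeff (N + m)) hid
        simp only [Matrix.add_apply, HahnSeries.coeff_add] at h5
        rw [h1, h2, h3, h4, zero_add] at h5
        rw [h5]
        congr 1
        split_ifs with h
        · rw [h]
        · rw [Matrix.sub_apply, hΛ₁ i k h, hM₁ i k h]; simp
      refine ⟨fun i k n hn => ?_, fun i k n hn => ?_⟩
      · rcases lt_or_eq_of_le (show n ≤ (m : ℤ) by push_cast at hn; omega) with h | h
        · exact hD i k n h
        · subst h
          by_cases hik : i = k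
          · subst hik; exact hDd i
          · have := heq i k
            rw [if_neg hik, add_zero, mul_comm, mul_eq_mul_left_iff] at this
            exact this.resolve_left (hsep i k hik)
      · rcases lt_or_eq_of_le (show n ≤ N + (m : ℤ) by push_cast at hn; omega) with h | h
        · exact hE i k n h
        · subst h
          by_cases hik : i = k
          · subst hik
            have := heq i i
            rw [hDd] at this
            simpa using this.symm
          · rw [Matrix.sub_apply, hΛ₁ i k hik, hM₁ i k hik]; simp
  obtain ⟨hD, hE⟩ := key (ℓ + 1) le_rfl
  refine ⟨fun i k n hn => ?_, fun i n hn => ?_⟩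
  · have := hD i k n (by push_cast; omega)
    rwa [Matrix.sub_apply, HahnSeries.coeff_sub, sub_eq_zero] at this
  · have := hE i i n (by push_cast; omega)
    rwa [Matrix.sub_apply, HahnSeries.coeff_sub, sub_eq_zero] at this
end

section
/- Let x₁, x₂, y₁, y₂ : ℂ → ℂ be differentiable. For t, z ∈ ℂ define the 2×2 complex matrices L(t,z) := [[z² + x₂(t)y₁(t) + t/2, −2y₁(t)z − 2y₂(t)], [x₂(t)z + x₁(t), −z² − x₂(t)y₁(t) − t/2]] and U(t,z) := [[z/2, −y₁(t)], [x₂(t)/2, −z/2]]. Then the zero-curvature equation ∂L/∂t (t,z) = U(t,z)·L(t,z) − L(t,z)·U(t,z) + ∂U/∂z (t,z) holds for all t and all z if and only if for all t: x₁′(t) = x₂(t)²y₁(t) + (t/2)x₂(t), x₂′(t) = −x₁(t), y₁′(t) = y₂(t), and y₂′(t) = −x₂(t)y₁(t)² − (t/2)y₁(t). -/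
attribute [local instance] Matrix.normedAddCommGroup Matrix.normedSpace

/-- The Painlevé II Lax matrix. -/
noncomputable def PIILax (x₁ x₂ y₁ y₂ : ℂ → ℂ) (t z : ℂ) : Matrix (Fin 2) (Fin 2) ℂ :=
  !![z ^ 2 + x₂ t * y₁ t + t / 2, -2 * y₁ t * z - 2 * y₂ t;
     x₂ t * z + x₁ t, -z ^ 2 - x₂ t * y₁ t - t / 2]

/-- The Painlevé II deformation matrix. -/
noncomputable def PIIDef (x₁ x₂ y₁ y₂ : ℂ → ℂ) (t z : ℂ) : Matrix (Fin 2) (Fin 2) ℂ :=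
  !![z / 2, -y₁ t; x₂ t / 2, -z / 2]

theorem PII_hasDerivAt_matrix (M : ℂ → Matrix (Fin 2) (Fin 2) ℂ) (N : Matrix (Fin 2) (Fin 2) ℂ)
    (t : ℂ) (h : ∀ i j, HasDerivAt (fun s => M s i j) (N i j) t) : HasDerivAt M N t :=
  hasDerivAt_pi.2 fun i => hasDerivAt_pi.2 fun j => h i j

theorem PIILax_deriv (x₁ x₂ y₁ y₂ : ℂ → ℂ)
    (hx₁ : Differentiable ℂ x₁) (hx₂ : Differentiable ℂ x₂)
    (hy₁ : Differentiable ℂ y₁) (hy₂ : Differentiable ℂ y₂) (t z : ℂ) :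
    deriv (fun s => PIILax x₁ x₂ y₁ y₂ s z) t =
      !![deriv x₂ t * y₁ t + x₂ t * deriv y₁ t + 1 / 2, -2 * deriv y₁ t * z - 2 * deriv y₂ t;
        deriv x₂ t * z + deriv x₁ t, -(deriv x₂ t * y₁ t + x₂ t * deriv y₁ t) - 1 / 2] := by
  have a := (hx₁ t).hasDerivAt
  have b := (hx₂ t).hasDerivAt
  have c := (hy₁ t).hasDerivAt
  have d := (hy₂ t).hasDerivAt
  have e := (hasDerivAt_id t).div_const 2
  refine (PII_hasDerivAt_matrix _ _ t ?_).deriv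
  intro i j
  fin_cases i <;> fin_cases j
  · exact ((b.mul c).const_add (z ^ 2)).add e
  · exact ((c.const_mul (-2)).mul_const z).sub (d.const_mul 2)
  · exact (b.mul_const z).add a
  · exact ((b.mul c).const_sub (-z ^ 2)).sub e

theorem PIIDef_deriv (x₁ x₂ y₁ y₂ : ℂ → ℂ) (t z : ℂ) :
    deriv (fun w => PIIDef x₁ x₂ y₁ y₂ t w) z = !![1 / 2, 0; 0, -1 / 2] := by
  have e := hasDerivAt_id z
  refine (PII_hasDerivAt_matrix _ _ z ?_).deriv
  intro i j
  fin_cases i <;> fin_cases j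
  · exact e.div_const 2
  · exact hasDerivAt_const z _
  · exact hasDerivAt_const z _
  · exact e.neg.div_const 2

/-- The zero-curvature equation `∂_t L = [U, L] + ∂_z U` for the Painlevé II Lax pair
holds for all `t, z` if and only if `(x₁, x₂, y₁, y₂)` satisfy Hamilton's equations for
the Painlevé II Hamiltonian `H_{II} = (1/2)(x₂²y₁² + t x₂ y₁ − 2 x₁ y₂)`. -/
theorem PII_zero_curvature_iff_hamilton
    (x₁ x₂ y₁ y₂ : ℂ → ℂ)
    (hx₁ : Differentiable ℂ x₁) (hx₂ : Differentiable ℂ x₂)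
    (hy₁ : Differentiable ℂ y₁) (hy₂ : Differentiable ℂ y₂) :
    (∀ t z : ℂ,
        deriv (fun s => PIILax x₁ x₂ y₁ y₂ s z) t =
          PIIDef x₁ x₂ y₁ y₂ t z * PIILax x₁ x₂ y₁ y₂ t z -
            PIILax x₁ x₂ y₁ y₂ t z * PIIDef x₁ x₂ y₁ y₂ t z +
            deriv (fun w => PIIDef x₁ x₂ y₁ y₂ t w) z)
      ↔
    (∀ t : ℂ,
        deriv x₁ t = x₂ t ^ 2 * y₁ t + (t / 2) * x₂ t ∧
        deriv x₂ t = -x₁ t ∧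
        deriv y₁ t = y₂ t ∧
        deriv y₂ t = -x₂ t * y₁ t ^ 2 - (t / 2) * y₁ t) := by
  simp only [PIILax_deriv x₁ x₂ y₁ y₂ hx₁ hx₂ hy₁ hy₂, PIIDef_deriv]
  constructor
  · intro h t
    have h0 := h t 0
    have h1 := h t 1
    have p0 := congrFun (congrFun h0 0) 1
    have q0 := congrFun (congrFun h0 1) 0
    have p1 := congrFun (congrFun h1 0) 1
    have q1 := congrFun (congrFun h1 1) 0
    simp [PIILax, PIIDef, Matrix.mul_apply, Fin.sum_univ_two] at p0 q0 p1 q1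
    refine ⟨?_, ?_, ?_, ?_⟩
    · linear_combination q0
    · linear_combination q1 - q0
    · linear_combination (p0 - p1) / 2
    · linear_combination -p0 / 2
  · intro h t z
    obtain ⟨a, b, c, d⟩ := h t
    rw [a, b, c, d]
    ext i j
    fin_cases i <;> fin_cases j <;>
      simp [PIILax, PIIDef, Matrix.mul_apply, Fin.sum_univ_two] <;> ring
end

section
/- Let x₁, x₂, y₁, y₂ : ℂ → ℂ be differentiable with x₂(t) ≠ 0 for all t. Define u := x₁/x₂, v := x₂·y₁, a := x₁y₁ + x₂y₂, and let w : ℂ → ℂ be any differentiable function with w′(t) = x₂′(t)/x₂(t) for all t. Then for all t: y₁(t)·x₁′(t) + y₂(t)·x₂′(t) = v(t)·u′(t) + a(t)·w′(t). -/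
/-- The coordinate change `(x₁,x₂,y₁,y₂) ↦ (u,v,w,a)` with `u = x₁/x₂`, `v = x₂y₁`,
`w = ln x₂`, `a = x₁y₁ + x₂y₂` is canonical for the Painlevé II phase space:
`y₁ dx₁ + y₂ dx₂ = v du + a dw`. -/
theorem PII_canonical_coordinate_change
    (x₁ x₂ y₁ y₂ w : ℂ → ℂ)
    (hx₁ : Differentiable ℂ x₁) (hx₂ : Differentiable ℂ x₂)
    (hy₁ : Differentiable ℂ y₁) (hy₂ : Differentiable ℂ y₂)
    (hx₂ne : ∀ t : ℂ, x₂ t ≠ 0)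
    (hw : Differentiable ℂ w)
    (hw' : ∀ t : ℂ, deriv w t = deriv x₂ t / x₂ t) :
    ∀ t : ℂ,
      y₁ t * deriv x₁ t + y₂ t * deriv x₂ t =
        (x₂ t * y₁ t) * deriv (fun s => x₁ s / x₂ s) t +
          (x₁ t * y₁ t + x₂ t * y₂ t) * deriv w t := by
  intro t
  have h := hx₂ne t
  have hd : deriv (fun s => x₁ s / x₂ s) t
      = (deriv x₁ t * x₂ t - x₁ t * deriv x₂ t) / x₂ t ^ 2 :=
    ((hx₁ t).hasDerivAt.div (hx₂ t).hasDerivAt h).deriv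
  rw [hd, hw' t]
  field_simp
  ring
end

section
/- Let x₁, x₂, x₃, y₁, y₂, y₃, t₁, t₂ ∈ ℂ, and let s ∈ ℂ with s² = 2. Define the 2×2 matrix L(z) := A(z)·σ₃ + B(z)·σ₊ + C(z)·σ₋, where σ₃ = diag(1,−1), σ₊ = [[0,1],[0,0]], σ₋ = [[0,0],[1,0]], and A(z) = z³ + (t₂ − x₁y₂)z − x₁y₃ − x₃y₂ + t₁, B(z) = −s·( x₁(z² + t₂/2) + x₃z + x₂ − (1/4)y₂x₁² ), C(z) = −s·( y₂(z² + t₂/2) + y₃z + y₁ − (1/4)x₁y₂² ). Then, as a polynomial in z, −det L(z) has: coefficient of z⁶ equal to 1; coefficient of z⁵ equal to 0; coefficient of z⁴ equal to 2t₂; coefficient of z³ equal to 2t₁; coefficient of z² equal to t₂² + 2a where a := x₁y₁ + x₂y₂ + x₃y₃; and coefficient of z equal to 2t₁t₂ + H₁, where H₁ := (3/2)x₁²y₂y₃ + ((3/2)x₃y₂² − 2t₁y₂ − t₂y₃)x₁ + 2x₂y₃ + (2y₁ − y₂t₂)x₃. -/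
open Matrix

/-- Spectral-curve computation for the traceless cubic `2×2` Lax matrix (`r = 2`,
`d_∞ = 4`, normalized to `t₄ = 1`, `t₃ = 0`): the coefficients of `−det L(z)` down to
degree `1` are `1, 0, 2t₂, 2t₁, t₂² + 2a, 2t₁t₂ + H₁`, where `a` is the exponent of
formal monodromy at infinity and `H₁` the spectral-invariant Hamiltonian dual to `t₁`. -/
theorem cubic_Lax_spectral_curve_coefficients
    (x₁ x₂ x₃ y₁ y₂ y₃ t₁ t₂ s : ℂ) (hs : s ^ 2 = 2) :
    ∃ c₀ : ℂ, ∀ z : ℂ,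
      -Matrix.det
          ((z ^ 3 + (t₂ - x₁ * y₂) * z - x₁ * y₃ - x₃ * y₂ + t₁) •
              (!![1, 0; 0, -1] : Matrix (Fin 2) (Fin 2) ℂ) +
            (-s * (x₁ * (z ^ 2 + t₂ / 2) + x₃ * z + x₂ - (1 / 4) * y₂ * x₁ ^ 2)) •
              (!![0, 1; 0, 0] : Matrix (Fin 2) (Fin 2) ℂ) +
            (-s * (y₂ * (z ^ 2 + t₂ / 2) + y₃ * z + y₁ - (1 / 4) * x₁ * y₂ ^ 2)) •
              (!![0, 0; 1, 0] : Matrix (Fin 2) (Fin 2) ℂ)) =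
        z ^ 6 + (0 : ℂ) * z ^ 5 + (2 * t₂) * z ^ 4 + (2 * t₁) * z ^ 3 +
          (t₂ ^ 2 + 2 * (x₁ * y₁ + x₂ * y₂ + x₃ * y₃)) * z ^ 2 +
          (2 * t₁ * t₂ +
            ((3 / 2) * x₁ ^ 2 * y₂ * y₃ +
              ((3 / 2) * x₃ * y₂ ^ 2 - 2 * t₁ * y₂ - t₂ * y₃) * x₁ +
              2 * x₂ * y₃ + (2 * y₁ - y₂ * t₂) * x₃)) * z +
          c₀ := by
  refine ⟨(t₁ - x₁ * y₃ - x₃ * y₂) ^ 2 +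
    2 * (x₁ * (t₂ / 2) + x₂ - (1 / 4) * y₂ * x₁ ^ 2) *
      (y₂ * (t₂ / 2) + y₁ - (1 / 4) * x₁ * y₂ ^ 2), fun z => ?_⟩
  rw [Matrix.det_fin_two]
  simp only [Matrix.add_apply, Matrix.smul_apply, Matrix.of_apply, Matrix.cons_val', Matrix.cons_val_zero,
    Matrix.cons_val_one, Matrix.cons_val_fin_one, smul_eq_mul]
  linear_combination
    (x₁ * (z ^ 2 + t₂ / 2) + x₃ * z + x₂ - (1 / 4) * y₂ * x₁ ^ 2) *
      (y₂ * (z ^ 2 + t₂ / 2) + y₃ * z + y₁ - (1 / 4) * x₁ * y₂ ^ 2) * hs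
end

section
/- Let u₁, u₂, v₁, v₂, w, a : ℂ → ℂ be differentiable functions and define x₁ := u₁·e^{w}, x₂ := u₂·e^{w}, x₃ := e^{w}, y₁ := v₁·e^{−w}, y₂ := v₂·e^{−w}, y₃ := (a − u₁v₁ − u₂v₂)·e^{−w}. Then for all t ∈ ℂ: y₁(t)·x₁′(t) + y₂(t)·x₂′(t) + y₃(t)·x₃′(t) = v₁(t)·u₁′(t) + v₂(t)·u₂′(t) + a(t)·w′(t). -/
/-- The coordinate change `(x₁,x₂,x₃,y₁,y₂,y₃) ↦ (u₁,u₂,v₁,v₂,w,a)` of Appendix A is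
canonical: with `x₁ = u₁e^w`, `x₂ = u₂e^w`, `x₃ = e^w`, `y₁ = v₁e^{−w}`, `y₂ = v₂e^{−w}`,
`y₃ = (a − u₁v₁ − u₂v₂)e^{−w}`, one has `Σᵢ yᵢ dxᵢ = v₁du₁ + v₂du₂ + a dw`. -/
theorem cubic_Lax_canonical_coordinate_change
    (u₁ u₂ v₁ v₂ w a : ℂ → ℂ)
    (hu₁ : Differentiable ℂ u₁) (hu₂ : Differentiable ℂ u₂)
    (hv₁ : Differentiable ℂ v₁) (hv₂ : Differentiable ℂ v₂)
    (hw : Differentiable ℂ w) (ha : Differentiable ℂ a) :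
    ∀ t : ℂ,
      (v₁ t * Complex.exp (-w t)) * deriv (fun s => u₁ s * Complex.exp (w s)) t +
        (v₂ t * Complex.exp (-w t)) * deriv (fun s => u₂ s * Complex.exp (w s)) t +
        ((a t - u₁ t * v₁ t - u₂ t * v₂ t) * Complex.exp (-w t)) *
          deriv (fun s => Complex.exp (w s)) t =
      v₁ t * deriv u₁ t + v₂ t * deriv u₂ t + a t * deriv w t := by
  intro t
  have hE := (hw t).hasDerivAt.cexp
  have h1 := (hu₁ t).hasDerivAt.fun_mul hE
  have h2 := (hu₂ t).hasDerivAt.fun_mul hE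
  rw [h1.deriv, h2.deriv, hE.deriv]
  have he : Complex.exp (-w t) * Complex.exp (w t) = 1 := by
    rw [← Complex.exp_add]; simp
  linear_combination (v₁ t * deriv u₁ t + v₂ t * deriv u₂ t + a t * deriv w t) * he
end
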